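/- Suppose y₁, …, y_m are positive reals satisfying, for every j ∈ {1,…,m}, the linear system P_{S_j} = Σ_{i=1}^{m} y_i · Σ_{ℓ ∈ S_i⊡S_j} P_{(S_j)_{ℓ+1}⋯(S_j)_{k_j}} (where k_j = |S_j| and the ℓ = k_j term contributes P_∅ = 1 when k_j ∈ S_i⊡S_j). Then for each j the probability that pattern j wins the game equals y_j / (Σ_{i=1}^{m} y_i), and the expected duration of the game equals 1 / (Σ_{i=1}^{m} y_i). -/

import Mathlib

open MeasureTheory ENNReal

def occursAt (S : List Bool) (ω : ℕ → Bool) (n : ℕ) : Prop :=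
  S.length ≤ n ∧ ∀ j < S.length, ω (n - S.length + j) = S.getD j false

/-- `P_W = p^{#H} q^{#T}`, the probability of generating the string `W`. -/
def strProb (p : ℝ) (W : List Bool) : ℝ :=
  p ^ W.count true * (1 - p) ^ W.count false

/-- The overlap set `W ⊡ S`. -/
def overlaps (W S : List Bool) : Finset ℕ :=
  (Finset.Icc 1 (min W.length S.length)).filter fun i => W.drop (W.length - i) = S.take i

/-- Pattern `i` wins the game at trial `n`. -/
def winsAt {m : ℕ} (S : Fin m → List Bool) (i : Fin m) (ω : ℕ → Bool) (n : ℕ) : Prop :=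
  occursAt (S i) ω n ∧ ∀ j : Fin m, ∀ l < n, ¬ occursAt (S j) ω l

/-- The duration of the game: the least `n` at which some pattern occurs ending at
trial `n` (`⊤` if no pattern ever occurs). -/
noncomputable def duration {m : ℕ} (S : Fin m → List Bool) (ω : ℕ → Bool) : ℕ∞ :=
  ⨅ (n : ℕ) (_ : ∃ i, occursAt (S i) ω n), (n : ℕ∞)

theorem strProb_cons (p : ℝ) (x : Bool) (W : List Bool) :
    strProb p (x :: W) = (if x then p else 1 - p) * strProb p W := by
  cases x <;> simp [strProb, pow_succ] <;> ring

theorem strProb_append (p : ℝ) (V W : List Bool) :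
    strProb p (V ++ W) = strProb p V * strProb p W := by
  simp only [strProb, List.count_append, pow_add]
  ring

theorem strProb_pos {p : ℝ} (hp0 : 0 < p) (hp1 : p < 1) (W : List Bool) : 0 < strProb p W :=
  mul_pos (pow_pos hp0 _) (pow_pos (sub_pos.2 hp1) _)

theorem mem_overlaps {W S : List Bool} {l : ℕ} :
    l ∈ overlaps W S ↔ (1 ≤ l ∧ l ≤ S.length) ∧ S.take l <:+ W := by
  simp only [overlaps, Finset.mem_filter, Finset.mem_Icc, le_min_iff]
  constructor
  · rintro ⟨⟨h1, h2, h3⟩, h4⟩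
    exact ⟨⟨h1, h3⟩, h4 ▸ List.drop_suffix _ _⟩
  · rintro ⟨⟨h1, h2⟩, h3⟩
    have hl : (S.take l).length = l := by simp [h2]
    have h4 := List.suffix_iff_eq_drop.1 h3
    rw [hl] at h4
    exact ⟨⟨h1, hl ▸ h3.length_le, h2⟩, h4.symm⟩

/-- The weighted correlation of `W` with `S`: the sum over all overlaps of the probability of
completing `S` from the overlap. -/
noncomputable def correlation (p : ℝ) (W S : List Bool) : ℝ :=
  ∑ l ∈ overlaps W S, strProb p (S.drop l)

theorem correlation_eq_sum_range (p : ℝ) (W S : List Bool) :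
    correlation p W S = ∑ l ∈ Finset.range S.length,
      if S.take (l + 1) <:+ W then strProb p (S.drop (l + 1)) else 0 := by
  rw [correlation, ← Finset.sum_filter]
  symm
  refine Finset.sum_bij (fun l _ => l + 1) ?_ ?_ ?_ ?_
  · intro l hl
    simp only [Finset.mem_filter, Finset.mem_range] at hl
    exact mem_overlaps.2 ⟨⟨by omega, by omega⟩, hl.2⟩
  · intro a _ b _ h
    omega
  · intro l hl
    obtain ⟨⟨h1, h2⟩, h3⟩ := mem_overlaps.1 hl
    obtain ⟨k, rfl⟩ := Nat.exists_eq_add_of_le' h1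
    exact ⟨k, by simp only [Finset.mem_filter, Finset.mem_range]; exact ⟨by omega, h3⟩, rfl⟩
  · intros; rfl

theorem correlation_nil (p : ℝ) (S : List Bool) : correlation p [] S = 0 := by
  simp [correlation, overlaps]

theorem append_singleton_suffix {V W : List Bool} {x y : Bool} :
    V ++ [x] <:+ W ++ [y] ↔ V <:+ W ∧ x = y := by
  rw [← List.reverse_prefix]
  simp [List.cons_prefix_cons, and_comm, List.reverse_prefix]

/-- One-step conditional expectation of the correlation. -/
theorem correlation_step (p : ℝ) {W S : List Bool} (h : ¬ S <:+ W) :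
    p * correlation p (W ++ [true]) S + (1 - p) * correlation p (W ++ [false]) S
      = correlation p W S + strProb p S := by
  set F : ℕ → ℝ := fun l => if S.take l <:+ W then strProb p (S.drop l) else 0 with hF
  have hL : p * correlation p (W ++ [true]) S + (1 - p) * correlation p (W ++ [false]) S
      = ∑ l ∈ Finset.range S.length, F l := by
    rw [correlation_eq_sum_range, correlation_eq_sum_range, Finset.mul_sum, Finset.mul_sum,
      ← Finset.sum_add_distrib]
    refine Finset.sum_congr rfl fun l hl => ?_
    have hl : l < S.length := Finset.mem_range.1 hl
    simp only [hF, ← List.take_concat_get' S l hl, append_singleton_suffix]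
    rw [List.drop_eq_getElem_cons hl, strProb_cons]
    by_cases hW : S.take l <:+ W <;> cases S[l] <;> simp [hW]
  have hR : correlation p W S = ∑ l ∈ Finset.range S.length, F (l + 1) :=
    correlation_eq_sum_range p W S
  have h0 : F 0 = strProb p S := by simp [hF]
  have hk : F S.length = 0 := by simp [hF, h]
  rw [hL, hR, ← h0, ← Finset.sum_range_succ', Finset.sum_range_succ, hk, add_zero]

theorem finite_range_overlaps (S : List Bool) : (Set.range fun W => overlaps W S).Finite := by
  refine (Finset.finite_toSet (Finset.Icc 1 S.length).powerset).subset ?_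
  rintro _ ⟨W, rfl⟩
  simp only [Finset.coe_powerset, Set.mem_preimage, Set.mem_powerset_iff, Finset.coe_subset]
  exact fun l hl => Finset.mem_Icc.2 (mem_overlaps.1 hl).1

theorem finite_range_sum_correlation (p : ℝ) {ι : Type*} [Fintype ι] (S : ι → List Bool)
    (a : ι → ℝ) : (Set.range fun W => ∑ j, correlation p W (S j) * a j).Finite := by
  refine ((Set.Finite.pi' fun j => finite_range_overlaps (S j)).image
    fun o => ∑ j, (∑ l ∈ o j, strProb p ((S j).drop l)) * a j).subset ?_
  rintro _ ⟨W, rfl⟩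
  exact ⟨fun j => overlaps W (S j), fun j => ⟨W, rfl⟩, rfl⟩

/-- Maximum principle on the binary tree: a function with finitely many values which has constant
drift `s ≥ 0` inside a region `A` that can always be left, and which vanishes at the root and on
leaving `A`, has no drift and is nonpositive on `A`. -/
theorem nonpos_of_drift {p s : ℝ} (hp0 : 0 < p) (hp1 : p < 1) (f : List Bool → ℝ)
    (A : List Bool → Prop) (hfin : (Set.range f).Finite) (hA : A []) (hf : f [] = 0)
    (hexit : ∀ W x, A W → ¬ A (W ++ [x]) → f (W ++ [x]) = 0)
    (hstep : ∀ W, A W → p * f (W ++ [true]) + (1 - p) * f (W ++ [false]) = f W + s)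
    (hleave : ∀ W, ∃ V, ¬ A (W ++ V)) (hs : 0 ≤ s) : s = 0 ∧ ∀ W, A W → f W ≤ 0 := by
  obtain ⟨_, ⟨W₀, hW₀, rfl⟩, hmax⟩ := Set.exists_max_image (f '' {W | A W}) id
    (hfin.subset (Set.image_subset_range _ _)) ⟨_, [], hA, rfl⟩
  have hle : ∀ W, A W → f W ≤ f W₀ := fun W hW => hmax _ ⟨W, hW, rfl⟩
  have h0 : 0 ≤ f W₀ := hf ▸ hle [] hA
  have hle' : ∀ W x, A W → f (W ++ [x]) ≤ f W₀ := fun W x hW => by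
    by_cases h : A (W ++ [x])
    · exact hle _ h
    · rw [hexit W x hW h]; exact h0
  have hq : 0 < 1 - p := sub_pos.2 hp1
  have hs0 : s = 0 := by
    have := hstep W₀ hW₀
    nlinarith [hle' W₀ true hW₀, hle' W₀ false hW₀]
  refine ⟨hs0, fun W hW => (hle W hW).trans ?_⟩
  by_contra! hpos
  have key : ∀ V, A (W₀ ++ V) ∧ f (W₀ ++ V) = f W₀ := by
    intro V
    induction V using List.reverseRecOn with
    | nil => simpa using hW₀
    | append_singleton V x ih =>
      rw [← List.append_assoc]
      have hx : f ((W₀ ++ V) ++ [x]) = f W₀ := by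
        have h1 := hstep _ ih.1
        have h2 := hle' _ true ih.1
        have h3 := hle' _ false ih.1
        rw [ih.2, hs0] at h1
        cases x
        · refine le_antisymm h3 (le_of_mul_le_mul_left ?_ hq)
          nlinarith
        · refine le_antisymm h2 (le_of_mul_le_mul_left ?_ hp0)
          nlinarith
      refine ⟨by_contra fun h => ?_, hx⟩
      rw [hexit _ x ih.1 h] at hx
      exact hpos.ne hx
  obtain ⟨V, hV⟩ := hleave W₀
  exact hV (key V).1

section Patterns

variable {m : ℕ} {S : Fin m → List Bool}

/-- No pattern occurs in `W`. -/
def Avoids (S : Fin m → List Bool) (W : List Bool) : Prop := ∀ i, ¬ S i <:+: W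

theorem infix_append_singleton {V W : List Bool} {x : Bool} :
    V <:+: W ++ [x] ↔ V <:+: W ∨ V <:+ W ++ [x] := by
  rw [List.infix_concat_iff, or_comm]

theorem take_suffix_of_suffix (hsub : ∀ i j, i ≠ j → ¬ S i <:+: S j) {i j : Fin m} {l : ℕ}
    {W : List Bool} (hi : S i <:+ W) (hl : (S j).take l <:+ W) : (S j).take l <:+ S i := by
  rcases List.suffix_or_suffix_of_suffix hi hl with h | h
  · have hij : i = j := by
      by_contra hne
      exact hsub i j hne (h.isInfix.trans (List.take_prefix _ _).isInfix)
    subst hij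
    rw [← h.eq_of_length_le (List.take_prefix l (S i)).length_le]
  · exact h

theorem correlation_of_suffix (p : ℝ) (hsub : ∀ i j, i ≠ j → ¬ S i <:+: S j) {i : Fin m}
    {W : List Bool} (hi : S i <:+ W) (j : Fin m) :
    correlation p W (S j) = correlation p (S i) (S j) := by
  have : overlaps W (S j) = overlaps (S i) (S j) := by
    ext l
    rw [mem_overlaps, mem_overlaps]
    exact and_congr_right fun _ => ⟨take_suffix_of_suffix hsub hi, fun h => h.trans hi⟩
  rw [correlation, correlation, this]

theorem correlation_tail (p : ℝ) (hS : ∀ i, S i ≠ []) (hsub : ∀ i j, i ≠ j → ¬ S i <:+: S j)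
    (i j : Fin m) :
    correlation p (S i) (S j) = correlation p (S i).tail (S j) + if j = i then 1 else 0 := by
  have hpos : 0 < (S i).length := List.length_pos_iff.2 (hS i)
  have hmem : ∀ l, (S j).take l <:+ S i → (S j).take l <:+ (S i).tail ∨ (S j).take l = S i := by
    intro l h
    obtain ⟨x, V, hV⟩ := List.exists_cons_of_ne_nil (hS i)
    rw [hV] at h ⊢
    rcases List.suffix_cons_iff.1 h with h | h
    · exact Or.inr h
    · exact Or.inl h
  have heq : ∀ l, (S j).take l = S i → j = i := by
    intro l h
    by_contra hne
    exact hsub i j (Ne.symm hne) (h ▸ (List.take_prefix l (S j)).isInfix)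
  split_ifs with hij
  · subst hij
    have hn : (S j).length ∉ overlaps (S j).tail (S j) := fun h => by
      have := (mem_overlaps.1 h).2.length_le
      simp at this
      omega
    have : overlaps (S j) (S j) = insert (S j).length (overlaps (S j).tail (S j)) := by
      ext l
      rw [Finset.mem_insert, mem_overlaps, mem_overlaps]
      constructor
      · rintro ⟨hl, h⟩
        rcases hmem l h with h | h
        · exact Or.inr ⟨hl, h⟩
        · left
          have := congrArg List.length h
          simp at this
          omega
      · rintro (rfl | ⟨hl, h⟩)
        · exact ⟨⟨hpos, le_rfl⟩, by simp⟩
        · exact ⟨hl, h.trans (List.tail_suffix _)⟩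
    rw [correlation, this, Finset.sum_insert hn, correlation, add_comm]
    simp [strProb]
  · have : overlaps (S i) (S j) = overlaps (S i).tail (S j) := by
      ext l
      rw [mem_overlaps, mem_overlaps]
      refine and_congr_right fun _ => ⟨fun h => ?_, fun h => h.trans (List.tail_suffix _)⟩
      exact (hmem l h).resolve_right fun h => hij (heq l h)
    rw [correlation, correlation, this, add_zero]

theorem avoids_tail (hS : ∀ i, S i ≠ []) (hsub : ∀ i j, i ≠ j → ¬ S i <:+: S j) (i : Fin m) :
    Avoids S (S i).tail := by
  intro j hj
  by_cases hij : j = i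
  · subst hij
    have h1 := hj.length_le
    have h2 : 0 < (S j).length := List.length_pos_iff.2 (hS j)
    simp at h1
    omega
  · exact hsub j i hij (hj.trans (List.tail_suffix _).isInfix)

/-- The correlation matrix of a reduced family of patterns has trivial kernel. -/
theorem eq_zero_of_correlation_mulVec {p : ℝ} (hp0 : 0 < p) (hp1 : p < 1) (hS : ∀ i, S i ≠ [])
    (hsub : ∀ i j, i ≠ j → ¬ S i <:+: S j) (a : Fin m → ℝ)
    (ha : ∀ i, ∑ j, correlation p (S i) (S j) * a j = 0) : a = 0 := by
  rcases isEmpty_or_nonempty (Fin m) with _ | ⟨⟨i₀⟩⟩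
  · exact Subsingleton.elim _ _
  have main : ∀ b : Fin m → ℝ, (∀ i, ∑ j, correlation p (S i) (S j) * b j = 0) →
      0 ≤ ∑ j, strProb p (S j) * b j → ∑ j, strProb p (S j) * b j = 0 ∧
        ∀ W, Avoids S W → ∑ j, correlation p W (S j) * b j ≤ 0 := by
    intro b hb hs
    refine nonpos_of_drift hp0 hp1 (fun W => ∑ j, correlation p W (S j) * b j) (Avoids S)
      (finite_range_sum_correlation p S b) ?_ ?_ ?_ ?_ ?_ hs
    · exact fun i hi => hS i (List.infix_nil.1 hi)
    · simp [correlation_nil]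
    · intro W x hW hx
      simp only [Avoids, not_forall, not_not] at hx
      obtain ⟨i, hi⟩ := hx
      have hi := (infix_append_singleton.1 hi).resolve_left (hW i)
      simp only [correlation_of_suffix p hsub hi, hb]
    · intro W hW
      simp only [Finset.mul_sum, ← Finset.sum_add_distrib]
      refine Finset.sum_congr rfl fun j _ => ?_
      rw [← add_mul, ← correlation_step p fun h => hW j h.isInfix]
      ring
    · exact fun W => ⟨S i₀, fun h => h i₀ (List.suffix_append _ _).isInfix⟩
  have hneg : ∀ c : Fin m → ℝ, ∑ j, c j * (-a) j = - ∑ j, c j * a j := fun c => by simp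
  have hs : ∑ j, strProb p (S j) * a j = 0 := by
    rcases le_total 0 (∑ j, strProb p (S j) * a j) with h | h
    · exact (main a ha h).1
    · have := (main (-a) (fun i => by rw [hneg, ha, neg_zero]) (by rw [hneg]; linarith)).1
      rw [hneg] at this
      linarith
  have hzero : ∀ W, Avoids S W → ∑ j, correlation p W (S j) * a j = 0 := fun W hW => by
    refine le_antisymm ((main a ha hs.ge).2 W hW) ?_
    have := (main (-a) (fun i => by rw [hneg, ha, neg_zero]) (by rw [hneg, hs, neg_zero])).2 W hW
    rw [hneg] at this
    linarith
  funext i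
  have h := ha i
  simp only [correlation_tail p hS hsub i, add_mul, Finset.sum_add_distrib,
    hzero _ (avoids_tail hS hsub i)] at h
  simpa using h

theorem eq_of_sum_mul_correlation_eq {p : ℝ} (hp0 : 0 < p) (hp1 : p < 1) (hS : ∀ i, S i ≠ [])
    (hsub : ∀ i j, i ≠ j → ¬ S i <:+: S j) (y z : Fin m → ℝ)
    (h : ∀ j, ∑ i, y i * correlation p (S i) (S j) = ∑ i, z i * correlation p (S i) (S j)) :
    y = z := by
  let M : Matrix (Fin m) (Fin m) ℝ := Matrix.of fun i j => correlation p (S i) (S j)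
  have hM : M.det ≠ 0 := fun h0 => by
    obtain ⟨v, hv, hMv⟩ := Matrix.exists_mulVec_eq_zero_iff.2 h0
    exact hv (eq_zero_of_correlation_mulVec hp0 hp1 hS hsub v fun i => congrFun hMv i)
  exact Matrix.vecMul_injective_of_isUnit ((Matrix.isUnit_iff_isUnit_det M).2 hM.isUnit)
    (funext h)

end Patterns

section Coin

/-- The string of the first `n` trials. -/
def initial (ω : ℕ → Bool) (n : ℕ) : List Bool := (List.range n).map ω

@[simp]
theorem length_initial (ω : ℕ → Bool) (n : ℕ) : (initial ω n).length = n := by simp [initial]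

theorem initial_succ (ω : ℕ → Bool) (n : ℕ) : initial ω (n + 1) = initial ω n ++ [ω n] := by
  simp [initial, List.range_succ]

theorem take_initial (ω : ℕ → Bool) {k n : ℕ} (h : k ≤ n) :
    (initial ω n).take k = initial ω k := by
  simp [initial, ← List.map_take, List.take_range, h]

theorem occursAt_iff_suffix {V : List Bool} {ω : ℕ → Bool} {n : ℕ} :
    occursAt V ω n ↔ V <:+ initial ω n := by
  constructor
  · rintro ⟨hn, h⟩
    rw [List.suffix_iff_eq_drop, length_initial]
    refine List.ext_getElem (by simp; omega) fun j h1 h2 => ?_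
    simp only [initial, List.getElem_drop, List.getElem_map, List.getElem_range, h j h1]
    simp [h1]
  · intro h
    have hn := h.length_le
    rw [length_initial] at hn
    refine ⟨hn, fun j hj => ?_⟩
    rw [List.suffix_iff_eq_drop, length_initial] at h
    rw [List.getD_eq_getElem _ _ hj]
    have := List.getElem_of_eq h hj
    rw [this]
    simp [initial]

theorem infix_initial {V : List Bool} {ω : ℕ → Bool} {n : ℕ} :
    V <:+: initial ω n ↔ ∃ l ≤ n, V <:+ initial ω l := by
  constructor
  · intro h
    obtain ⟨t, ht, htn⟩ := List.infix_iff_suffix_prefix.1 h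
    have hl : t.length ≤ n := by simpa using htn.length_le
    refine ⟨t.length, hl, ?_⟩
    rwa [← take_initial ω hl, ← List.prefix_iff_eq_take.1 htn]
  · rintro ⟨l, hl, h⟩
    rw [← take_initial ω hl] at h
    exact h.isInfix.trans (List.take_prefix _ _).isInfix

theorem measurableSet_initial (P : List Bool → Prop) (n : ℕ) :
    MeasurableSet {ω : ℕ → Bool | P (initial ω n)} := by
  have hm : Measurable fun (ω : ℕ → Bool) (i : Fin n) => ω i :=
    measurable_pi_lambda _ fun i => measurable_pi_apply _
  convert hm (MeasurableSet.of_discrete (s := {b : Fin n → Bool | P (List.ofFn b)})) using 1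
  ext ω
  simp only [Set.mem_ofPred_eq, Set.mem_preimage]
  rw [show initial ω n = List.ofFn fun i : Fin n => ω i from
    List.ext_getElem (by simp) fun j h1 h2 => by simp [initial]]

variable {p : ℝ} {μ : Measure (ℕ → Bool)}

theorem measure_initial_inter_next
    (hμ : ∀ (n : ℕ) (b : ℕ → Bool), μ {ω | ∀ i < n, ω i = b i}
      = ∏ i ∈ Finset.range n, (if b i then ENNReal.ofReal p else ENNReal.ofReal (1 - p)))
    (P : List Bool → Prop) (n : ℕ) (x : Bool) :
    μ {ω | P (initial ω n) ∧ ω n = x} = μ {ω | P (initial ω n)} *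
      (if x then ENNReal.ofReal p else ENNReal.ofReal (1 - p)) := by
  classical
  set r : (ℕ → Bool) → Fin n → Bool := fun ω i => ω i with hr
  have hm : Measurable r := measurable_pi_lambda _ fun i => measurable_pi_apply _
  set B : Finset (Fin n → Bool) := Finset.univ.filter fun b => P (List.ofFn b) with hB
  have hP : {ω : ℕ → Bool | P (initial ω n)} = r ⁻¹' B := by
    ext ω
    simp only [hB, hr, Finset.coe_filter, Finset.mem_univ, true_and, Set.preimage_ofPred_eq,
      Set.mem_ofPred_eq]
    rw [show initial ω n = List.ofFn fun i : Fin n => ω i from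
      List.ext_getElem (by simp) fun j h1 h2 => by simp [initial]]
  have hsing : ∀ b, MeasurableSet (r ⁻¹' {b}) := fun b => hm (MeasurableSet.of_discrete)
  have hx : MeasurableSet {ω : ℕ → Bool | ω n = x} :=
    measurableSet_eq_fun (measurable_pi_apply n) measurable_const
  have hPm := measurableSet_initial P n
  change μ ({ω | P (initial ω n)} ∩ {ω | ω n = x}) = _
  rw [← Measure.restrict_apply hPm, hP,
    ← sum_measure_preimage_singleton (μ := μ) B fun b _ => hsing b,
    ← sum_measure_preimage_singleton B fun b _ => hsing b, Finset.sum_mul]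
  refine Finset.sum_congr rfl fun b _ => ?_
  rw [Measure.restrict_apply (hsing b)]
  set e : ℕ → Bool := fun i => if h : i < n then b ⟨i, h⟩ else x with he
  have hen : e n = x := by simp [he]
  have h1 : r ⁻¹' {b} = {ω | ∀ i < n, ω i = e i} := by
    ext ω
    simp only [hr, Set.mem_preimage, Set.mem_singleton_iff, Set.mem_ofPred_eq, funext_iff]
    constructor
    · intro h i hi
      simp [he, hi, ← h ⟨i, hi⟩]
    · intro h i
      simp [he, h i i.2]
  have h2 : r ⁻¹' {b} ∩ {ω | ω n = x} = {ω | ∀ i < n + 1, ω i = e i} := by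
    rw [h1]
    ext ω
    simp only [Set.mem_inter_iff, Set.mem_ofPred_eq, Nat.lt_succ_iff_lt_or_eq, or_imp,
      forall_and, forall_eq, hen]
  rw [h2, h1, hμ, hμ, Finset.prod_range_succ, hen]

/-- Later trials are independent of the first `n`. -/
theorem measure_initial_append (hp0 : 0 < p) (hp1 : p < 1)
    (hμ : ∀ (n : ℕ) (b : ℕ → Bool), μ {ω | ∀ i < n, ω i = b i}
      = ∏ i ∈ Finset.range n, (if b i then ENNReal.ofReal p else ENNReal.ofReal (1 - p)))
    (P : List Bool → Prop) (n : ℕ) (V : List Bool) :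
    μ {ω | P (initial ω n) ∧ initial ω (n + V.length) = initial ω n ++ V}
      = μ {ω | P (initial ω n)} * ENNReal.ofReal (strProb p V) := by
  induction V using List.reverseRecOn with
  | nil => simp [strProb]
  | append_singleton V x ih =>
    have h1 := measure_initial_inter_next hμ
      (fun W => P (W.take n) ∧ W = W.take n ++ V) (n + V.length) x
    simp only [take_initial _ (Nat.le_add_right n V.length)] at h1
    rw [ih, mul_assoc] at h1
    convert h1 using 2
    · ext ω
      simp only [List.length_append, List.length_singleton, ← add_assoc, initial_succ,
        ← List.append_assoc, Set.mem_ofPred_eq, and_assoc]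
      refine and_congr_right fun _ => ?_
      rw [← List.concat_eq_append, ← List.concat_eq_append, List.concat_inj]
    · rw [strProb_append, ENNReal.ofReal_mul (strProb_pos hp0 hp1 V).le, strProb_cons]
      cases x <;> simp [strProb]

end Coin

section Game

variable {m : ℕ} {S : Fin m → List Bool}

theorem avoids_initial_iff {ω : ℕ → Bool} {n : ℕ} :
    Avoids S (initial ω n) ↔ ∀ i, ∀ l ≤ n, ¬ occursAt (S i) ω l := by
  simp only [Avoids, infix_initial, occursAt_iff_suffix, not_exists, not_and]

theorem winsAt_iff_initial (hS : ∀ i, S i ≠ []) {i : Fin m} {ω : ℕ → Bool} {n : ℕ} :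
    winsAt S i ω n ↔ S i <:+ initial ω n ∧ Avoids S (initial ω n).dropLast := by
  rw [winsAt, occursAt_iff_suffix]
  refine and_congr_right fun h => ?_
  rcases n with _ | n
  · exact absurd (List.suffix_nil.1 h) (hS i)
  · rw [initial_succ, List.dropLast_concat, avoids_initial_iff]
    simp only [Nat.lt_succ_iff]

theorem winsAt_unique (hsub : ∀ i j, i ≠ j → ¬ S i <:+: S j) {i j : Fin m} {ω : ℕ → Bool}
    {k n : ℕ} (hi : winsAt S i ω k) (hj : winsAt S j ω n) : i = j ∧ k = n := by
  have hkn : k = n := by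
    rcases lt_trichotomy k n with h | h | h
    · exact absurd hi.1 (hj.2 i k h)
    · exact h
    · exact absurd hj.1 (hi.2 j n h)
  subst hkn
  refine ⟨by_contra fun hne => ?_, rfl⟩
  rcases List.suffix_or_suffix_of_suffix (occursAt_iff_suffix.1 hi.1)
    (occursAt_iff_suffix.1 hj.1) with h | h
  · exact hsub i j hne h.isInfix
  · exact hsub j i (Ne.symm hne) h.isInfix

theorem exists_winsAt {ω : ℕ → Bool} {n : ℕ} {i : Fin m} (h : occursAt (S i) ω n) :
    ∃ j, ∃ k ≤ n, winsAt S j ω k := by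
  classical
  have hex : ∃ k, ∃ j, occursAt (S j) ω k := ⟨n, i, h⟩
  obtain ⟨j, hj⟩ := Nat.find_spec hex
  exact ⟨j, _, Nat.find_min' hex ⟨i, h⟩, hj, fun j' l hl h' => Nat.find_min hex hl ⟨j', h'⟩⟩

/-- If no pattern occurs in the first `n` trials and the next ones spell `S j`, the game is won at
an overlap of the winner with `S j`, and conversely. -/
theorem avoids_append_iff (hsub : ∀ i j, i ≠ j → ¬ S i <:+: S j)
    (j : Fin m) (ω : ℕ → Bool) (n : ℕ) :
    (Avoids S (initial ω n) ∧ initial ω (n + (S j).length) = initial ω n ++ S j) ↔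
      ∃ i, ∃ l ∈ overlaps (S i) (S j), winsAt S i ω (n + l) ∧
        initial ω (n + l + ((S j).drop l).length) = initial ω (n + l) ++ (S j).drop l := by
  constructor
  · rintro ⟨hA, hj⟩
    have hocc : occursAt (S j) ω (n + (S j).length) :=
      occursAt_iff_suffix.2 (hj ▸ List.suffix_append _ _)
    obtain ⟨i, k, hk, hi⟩ := exists_winsAt hocc
    have hnk : n < k := by
      by_contra! h
      exact avoids_initial_iff.1 hA i k h hi.1
    obtain ⟨l, rfl⟩ := Nat.exists_eq_add_of_lt hnk
    rw [add_assoc] at hk hi hnk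
    set l' := l + 1
    have hl : l' ≤ (S j).length := by omega
    have hnl : initial ω (n + l') = initial ω n ++ (S j).take l' := by
      rw [← take_initial ω hk, hj, List.take_append]
      simp
    refine ⟨i, l', mem_overlaps.2 ⟨⟨by omega, hl⟩, ?_⟩, hi, ?_⟩
    · exact take_suffix_of_suffix hsub (occursAt_iff_suffix.1 hi.1)
        (hnl ▸ List.suffix_append _ _)
    · rw [hnl, List.append_assoc, List.take_append_drop, ← hj, List.length_drop]
      congr 1
      omega
  · rintro ⟨i, l, hl, hi, h⟩
    obtain ⟨⟨h1, h2⟩, h3⟩ := mem_overlaps.1 hl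
    refine ⟨avoids_initial_iff.2 fun i' l' hl' => hi.2 i' l' (by omega), ?_⟩
    obtain ⟨X, hX⟩ := h3.trans (occursAt_iff_suffix.1 hi.1)
    have hXn : X = initial ω n := by
      have hlen := congrArg List.length hX
      simp only [List.length_append, List.length_take, length_initial] at hlen
      rw [← take_initial ω (Nat.le_add_right n l), ← hX]
      exact (List.take_left' (by omega)).symm
    rw [← hX, hXn, List.append_assoc, List.take_append_drop, List.length_drop] at h
    rw [← h]
    congr 1
    omega

theorem measurableSet_winsAt (hS : ∀ i, S i ≠ []) (i : Fin m) (n : ℕ) :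
    MeasurableSet {ω | winsAt S i ω n} := by
  simp only [winsAt_iff_initial hS]
  exact measurableSet_initial (fun W => S i <:+ W ∧ Avoids S W.dropLast) n

variable {p : ℝ} {μ : Measure (ℕ → Bool)}

theorem measure_avoids_mul_strProb (hp0 : 0 < p) (hp1 : p < 1)
    (hμ : ∀ (n : ℕ) (b : ℕ → Bool), μ {ω | ∀ i < n, ω i = b i}
      = ∏ i ∈ Finset.range n, (if b i then ENNReal.ofReal p else ENNReal.ofReal (1 - p)))
    (hS : ∀ i, S i ≠ []) (hsub : ∀ i j, i ≠ j → ¬ S i <:+: S j) (j : Fin m) (n : ℕ) :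
    μ {ω | Avoids S (initial ω n)} * ENNReal.ofReal (strProb p (S j))
      = ∑ i, ∑ l ∈ overlaps (S i) (S j),
        μ {ω | winsAt S i ω (n + l)} * ENNReal.ofReal (strProb p ((S j).drop l)) := by
  have hwin : ∀ i l, {ω | winsAt S i ω (n + l) ∧
      initial ω (n + l + ((S j).drop l).length) = initial ω (n + l) ++ (S j).drop l}
      = {ω | (S i <:+ initial ω (n + l) ∧ Avoids S (initial ω (n + l)).dropLast) ∧
      initial ω (n + l + ((S j).drop l).length) = initial ω (n + l) ++ (S j).drop l} :=
    fun i l => by simp only [winsAt_iff_initial hS]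
  have hmul : ∀ i l, μ {ω | winsAt S i ω (n + l) ∧
      initial ω (n + l + ((S j).drop l).length) = initial ω (n + l) ++ (S j).drop l}
      = μ {ω | winsAt S i ω (n + l)} * ENNReal.ofReal (strProb p ((S j).drop l)) := by
    intro i l
    rw [hwin, measure_initial_append hp0 hp1 hμ
      (fun W => S i <:+ W ∧ Avoids S W.dropLast) (n + l)]
    simp only [winsAt_iff_initial hS]
  rw [← measure_initial_append hp0 hp1 hμ (Avoids S) n (S j)]
  simp only [← hmul]
  rw [Finset.sum_sigma', ← measure_biUnion_finset]
  · congr 1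
    ext ω
    simp only [avoids_append_iff hsub j ω n, Set.mem_ofPred_eq, Set.mem_iUnion, Finset.mem_sigma,
      Finset.mem_univ, true_and, Sigma.exists, exists_prop]
  · rintro ⟨i, l⟩ _ ⟨i', l'⟩ _ hne
    refine Set.disjoint_left.2 fun ω h h' => hne ?_
    obtain ⟨rfl, hl⟩ := winsAt_unique hsub h.1 h'.1
    obtain rfl : l = l' := Nat.add_left_cancel hl
    rfl
  · rintro ⟨i, l⟩ _
    simp only
    rw [hwin]
    convert measurableSet_initial (fun W => (S i <:+ W.take (n + l) ∧
      Avoids S (W.take (n + l)).dropLast) ∧ W = W.take (n + l) ++ (S j).drop l)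
      (n + l + ((S j).drop l).length) using 3 with ω
    rw [take_initial ω (Nat.le_add_right _ _)]

theorem measure_exists_winsAt (hS : ∀ i, S i ≠ []) (hsub : ∀ i j, i ≠ j → ¬ S i <:+: S j)
    (i : Fin m) {l : ℕ} (hl : l ≤ (S i).length) :
    ∑' n, μ {ω | winsAt S i ω (n + l)} = μ {ω | ∃ n, winsAt S i ω n} := by
  have hU : {ω | ∃ n, winsAt S i ω n} = ⋃ n, {ω | winsAt S i ω n} := by
    ext ω
    simp
  rw [hU, measure_iUnion _ (measurableSet_winsAt hS i)]
  · refine (add_left_injective l).tsum_eq (f := fun n => μ {ω | winsAt S i ω n}) ?_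
    intro n hn
    by_contra h
    refine hn ?_
    have hempty : {ω | winsAt S i ω n} = ∅ := by
      refine Set.eq_empty_of_forall_notMem fun ω hω => h ⟨n - l, ?_⟩
      have := hω.1.1
      simp only
      omega
    simp [hempty]
  · intro k n hkn
    exact Set.disjoint_left.2 fun ω h h' => hkn (winsAt_unique hsub h h').2

theorem lt_duration_iff {ω : ℕ → Bool} {n : ℕ} :
    (n : ℕ∞) < duration S ω ↔ Avoids S (initial ω n) := by
  rw [avoids_initial_iff, ← ENat.add_one_le_iff (ENat.natCast_ne_top n), duration]
  simp only [le_iInf_iff, forall_exists_index]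
  constructor
  · intro h i l hl ho
    have := h l i ho
    norm_cast at this
    omega
  · intro h l i ho
    have : n < l := by
      by_contra! hl
      exact h i l hl ho
    exact_mod_cast this

theorem ENat.toENNReal_eq_tsum (d : ℕ∞) :
    (d : ℝ≥0∞) = ∑' n : ℕ, {k : ℕ | (k : ℕ∞) < d}.indicator 1 n := by
  induction d using ENat.recTopCoe with
  | top => simp [Set.indicator]
  | coe d =>
    rw [tsum_eq_sum (s := Finset.range d) fun n hn => by simpa [Set.indicator] using hn,
      Finset.sum_congr rfl fun n hn => Set.indicator_of_mem (by simpa using hn) _]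
    simp

theorem lintegral_duration :
    ∫⁻ ω, (duration S ω : ℝ≥0∞) ∂μ = ∑' n, μ {ω | Avoids S (initial ω n)} := by
  have h : ∀ n, {ω | Avoids S (initial ω n)}.indicator 1
      = fun ω => {k : ℕ | (k : ℕ∞) < duration S ω}.indicator (1 : ℕ → ℝ≥0∞) n := by
    intro n
    ext ω
    simp only [lt_duration_iff]
    by_cases hA : Avoids S (initial ω n)
    · rw [Set.indicator_of_mem (by exact hA), Set.indicator_of_mem (by exact hA)]
      rfl
    · rw [Set.indicator_of_notMem (by exact hA), Set.indicator_of_notMem (by exact hA)]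
  simp only [ENat.toENNReal_eq_tsum]
  rw [lintegral_tsum]
  · refine tsum_congr fun n => ?_
    rw [← h, lintegral_indicator_one (measurableSet_initial _ n)]
  · intro n
    rw [← h]
    exact (measurable_one.indicator (measurableSet_initial _ n)).aemeasurable

theorem lintegral_duration_mul_strProb (hp0 : 0 < p) (hp1 : p < 1)
    (hμ : ∀ (n : ℕ) (b : ℕ → Bool), μ {ω | ∀ i < n, ω i = b i}
      = ∏ i ∈ Finset.range n, (if b i then ENNReal.ofReal p else ENNReal.ofReal (1 - p)))
    (hS : ∀ i, S i ≠ []) (hsub : ∀ i j, i ≠ j → ¬ S i <:+: S j) (j : Fin m) :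
    (∫⁻ ω, (duration S ω : ℝ≥0∞) ∂μ) * ENNReal.ofReal (strProb p (S j))
      = ∑ i, μ {ω | ∃ n, winsAt S i ω n} * ENNReal.ofReal (correlation p (S i) (S j)) := by
  rw [lintegral_duration, ← ENNReal.tsum_mul_right]
  simp only [measure_avoids_mul_strProb hp0 hp1 hμ hS hsub]
  rw [Summable.tsum_finsetSum fun _ _ => ENNReal.summable]
  refine Finset.sum_congr rfl fun i _ => ?_
  rw [Summable.tsum_finsetSum fun _ _ => ENNReal.summable, correlation,
    ENNReal.ofReal_sum_of_nonneg fun l _ => (strProb_pos hp0 hp1 _).le, Finset.mul_sum]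
  refine Finset.sum_congr rfl fun l hl => ?_
  rw [ENNReal.tsum_mul_right, measure_exists_winsAt hS hsub i]
  have := (mem_overlaps.1 hl).2.length_le
  rwa [List.length_take_of_le (mem_overlaps.1 hl).1.2] at this

theorem sum_measure_winsAt [IsProbabilityMeasure μ] (hS : ∀ i, S i ≠ [])
    (hsub : ∀ i j, i ≠ j → ¬ S i <:+: S j) (hfin : ∫⁻ ω, (duration S ω : ℝ≥0∞) ∂μ ≠ ∞) :
    ∑ i, μ {ω | ∃ n, winsAt S i ω n} = 1 := by
  have hmeas : ∀ i, MeasurableSet {ω | ∃ n, winsAt S i ω n} := fun i => by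
    rw [Set.ofPred_exists]
    exact MeasurableSet.iUnion (measurableSet_winsAt hS i)
  rw [← measure_biUnion_finset _ fun i _ => hmeas i, prob_compl_eq_zero_iff _ |>.symm]
  · rw [lintegral_duration] at hfin
    by_contra hne
    refine hfin (top_unique ?_)
    rw [← ENNReal.tsum_const_eq_top_of_ne_zero (α := ℕ) hne]
    refine ENNReal.tsum_le_tsum fun n => measure_mono fun ω hω => ?_
    refine avoids_initial_iff.2 fun i l _ ho => hω ?_
    obtain ⟨j, k, _, hk⟩ := exists_winsAt ho
    simp only [Finset.mem_univ, Set.iUnion_true, Set.mem_iUnion]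
    exact ⟨j, k, hk⟩
  · exact Finset.measurableSet_biUnion _ fun i _ => hmeas i
  · intro i _ j _ hij
    refine Set.disjoint_left.2 ?_
    rintro ω ⟨k, hk⟩ ⟨n, hn⟩
    exact hij (winsAt_unique hsub hk hn).1

end Game

theorem stmt16 (p : ℝ) (hp0 : 0 < p) (hp1 : p < 1)
    (μ : Measure (ℕ → Bool)) [IsProbabilityMeasure μ]
    (hμ : ∀ (n : ℕ) (b : ℕ → Bool),
      μ {ω | ∀ i < n, ω i = b i}
        = ∏ i ∈ Finset.range n, (if b i then ENNReal.ofReal p else ENNReal.ofReal (1 - p)))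
    (m : ℕ) (hm : 1 ≤ m) (S : Fin m → List Bool) (hS : ∀ i, S i ≠ [])
    (hsub : ∀ i j, i ≠ j → ¬ S i <:+: S j)
    (y : Fin m → ℝ) (hy : ∀ i, 0 < y i)
    (hsys : ∀ j, strProb p (S j)
      = ∑ i : Fin m, y i * ∑ ℓ ∈ overlaps (S i) (S j), strProb p ((S j).drop ℓ)) :
    (∀ j, μ {ω | ∃ n, winsAt S j ω n} = ENNReal.ofReal (y j / ∑ i : Fin m, y i)) ∧
    ∫⁻ ω, (duration S ω : ℝ≥0∞) ∂μ = ENNReal.ofReal (1 / ∑ i : Fin m, y i) := by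
  have hcorr : ∀ i j, 0 ≤ correlation p (S i) (S j) := fun i j =>
    Finset.sum_nonneg fun l _ => (strProb_pos hp0 hp1 _).le
  have hren := lintegral_duration_mul_strProb hp0 hp1 hμ hS hsub
  have hfin : ∫⁻ ω, (duration S ω : ℝ≥0∞) ∂μ ≠ ∞ := by
    intro h
    have h1 := hren ⟨0, hm⟩
    rw [h, ENNReal.top_mul (ENNReal.ofReal_pos.2 (strProb_pos hp0 hp1 _)).ne'] at h1
    exact ENNReal.sum_ne_top.2
      (fun i _ => ENNReal.mul_ne_top (measure_ne_top _ _) ENNReal.ofReal_ne_top) h1.symm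
  have hsum := sum_measure_winsAt hS hsub hfin
  set E := (∫⁻ ω, (duration S ω : ℝ≥0∞) ∂μ).toReal with hE
  have hwin : (fun i => (μ {ω | ∃ n, winsAt S i ω n}).toReal) = fun i => E * y i := by
    refine eq_of_sum_mul_correlation_eq hp0 hp1 hS hsub _ _ fun j => ?_
    have h1 := congrArg ENNReal.toReal (hren j)
    rw [ENNReal.toReal_mul, ENNReal.toReal_ofReal (strProb_pos hp0 hp1 _).le,
      ENNReal.toReal_sum fun i _ => ENNReal.mul_ne_top (measure_ne_top _ _) ENNReal.ofReal_ne_top]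
      at h1
    simp only [ENNReal.toReal_mul, ENNReal.toReal_ofReal (hcorr _ _)] at h1
    rw [← h1, hsys j, Finset.mul_sum]
    exact Finset.sum_congr rfl fun i _ => (mul_assoc _ _ _).symm
  have hEy : E * ∑ i, y i = 1 := by
    have h1 := congrArg ENNReal.toReal hsum
    rw [ENNReal.toReal_sum fun i _ => measure_ne_top _ _, ENNReal.toReal_one] at h1
    rw [Finset.mul_sum, ← h1]
    exact Finset.sum_congr rfl fun i _ => (congrFun hwin i).symm
  have hE' : E = 1 / ∑ i, y i := eq_one_div_of_mul_eq_one_left hEy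
  constructor
  · intro j
    rw [← ENNReal.ofReal_toReal (measure_ne_top μ {ω | ∃ n, winsAt S j ω n}), congrFun hwin j, hE']
    congr 1
    ring
  · rw [← hE', hE, ENNReal.ofReal_toReal hfin]
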